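/- Let n ≥ 5 and let {D_{i,j,k}} be real numbers indexed by the 3-subsets of [n] such that for all distinct i, j the expression (2/3)(D_{i,j,r}+D_{i,j,s}+D_{i,j,u}+D_{r,s,u}) − (1/3)(D_{i,r,s}+D_{i,r,u}+D_{i,s,u}+D_{j,r,s}+D_{j,r,u}+D_{j,s,u}) does not depend on the choice of distinct r, s, u ∈ [n]∖{i,j}; denote its common value by D_{i,j}. Suppose α, α′, α″ ∈ [n] are distinct and the conditions ∗^{α,α′}, ∗^{α,α″} and ∗^{α′,α″} all hold. Then the quantity ½(D_{α,α′} + D_{α,x,y} − D_{α′,x,y}) does not depend on the choice of distinct x, y ∈ [n]∖{α,α′}, and it equals ½(D_{α,α″} + D_{α,x′,y′} − D_{α″,x′,y′}) for any distinct x′, y′ ∈ [n]∖{α,α″}. -/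

import Mathlib

/-- Condition `∗^{a,b}` for a family of real numbers indexed by the `3`-subsets
of `[n]`: `D {a,x,y} - D {b,x,y}` does not depend on the choice of the
distinct `x, y ∈ [n] ∖ {a,b}`. -/
def StarTriple {n : ℕ} (D : Finset (Fin n) → ℝ) (a b : Fin n) : Prop :=
  ∃ c : ℝ, ∀ x y : Fin n, x ≠ y → x ≠ a → x ≠ b → y ≠ a → y ≠ b →
    D {a, x, y} - D {b, x, y} = c

/-- The expression of Condition 2, whose common value (when it is independent of
`r, s, u`) is the double weight `D_{i,j}`. -/
noncomputable def pairExpr {n : ℕ} (D : Finset (Fin n) → ℝ) (i j r s u : Fin n) : ℝ :=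
  2/3 * (D {i, j, r} + D {i, j, s} + D {i, j, u} + D {r, s, u}) -
    1/3 * (D {i, r, s} + D {i, r, u} + D {i, s, u} +
           D {j, r, s} + D {j, r, u} + D {j, s, u})

/-- if the double weights `Dp i j` are well defined by Condition 2
and `α, α', α''` are distinct elements pairwise satisfying `∗`, then the twig
value `½(D_{α,α'} + D_{α,x,y} - D_{α',x,y})` does not depend on the choice of
the distinct `x, y ∈ [n] ∖ {α,α'}`, and it equals
`½(D_{α,α''} + D_{α,x',y'} - D_{α'',x',y'})` for any distinct
`x', y' ∈ [n] ∖ {α,α''}`. -/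
theorem twig_well_defined (n : ℕ) (hn : 5 ≤ n) (D : Finset (Fin n) → ℝ)
    (Dp : Fin n → Fin n → ℝ)
    (hDp : ∀ i j : Fin n, i ≠ j → ∀ r s u : Fin n,
      r ≠ s → r ≠ u → s ≠ u → r ≠ i → r ≠ j → s ≠ i → s ≠ j → u ≠ i → u ≠ j →
      pairExpr D i j r s u = Dp i j)
    (α α' α'' : Fin n) (h1 : α ≠ α') (h2 : α ≠ α'') (h3 : α' ≠ α'')
    (s1 : StarTriple D α α') (s2 : StarTriple D α α'')
    (s3 : StarTriple D α' α'') :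
    ∀ x y x' y' : Fin n,
      x ≠ y → x ≠ α → x ≠ α' → y ≠ α → y ≠ α' →
      x' ≠ y' → x' ≠ α → x' ≠ α'' → y' ≠ α → y' ≠ α'' →
      (Dp α α' + D {α, x, y} - D {α', x, y}) / 2 =
        (Dp α α'' + D {α, x', y'} - D {α'', x', y'}) / 2 := by
  intro x y x' y' hxy hxa hxb hya hyb hxy' hxa' hxc' hya' hyc'
  obtain ⟨c₁, k₁⟩ := s1
  obtain ⟨c₂, k₂⟩ := s2
  obtain ⟨c₃, k₃⟩ := s3
  obtain ⟨d, e, hde, hda, hdb, hdc, hea, heb, hec⟩ :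
      ∃ d e : Fin n, d ≠ e ∧ d ≠ α ∧ d ≠ α' ∧ d ≠ α'' ∧ e ≠ α ∧ e ≠ α' ∧ e ≠ α'' := by
    have hcard : 1 < ({α, α', α''}ᶜ : Finset (Fin n)).card := by
      have := Finset.card_le_three (a := α) (b := α') (c := α'')
      rw [Finset.card_compl, Fintype.card_fin]
      omega
    obtain ⟨d, hd, e, he, hde⟩ := Finset.one_lt_card.mp hcard
    simp only [Finset.mem_compl, Finset.mem_insert, Finset.mem_singleton, not_or] at hd he
    exact ⟨d, e, hde, hd.1, hd.2.1, hd.2.2, he.1, he.2.1, he.2.2⟩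
  have pab := hDp α α' h1 α'' d e hdc.symm hec.symm hde h2.symm h3.symm hda hdb hea heb
  have pac := hDp α α'' h2 α' d e hdb.symm heb.symm hde h1.symm h3 hda hdc hea hec
  have tab := k₁ d e hde hda hdb hea heb
  have tac := k₂ d e hde hda hdc hea hec
  have tbc := k₃ d e hde hdb hdc heb hec
  have tbc_d := k₃ α d hda.symm h1 h2 hdb hdc
  have tbc_e := k₃ α e hea.symm h1 h2 heb hec
  have txy := k₁ x y hxy hxa hxb hya hyb
  have txy' := k₂ x' y' hxy' hxa' hxc' hya' hyc'
  unfold pairExpr at pab pac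
  rw [Finset.pair_comm α'' α', Finset.insert_comm α'' α' {d},
    Finset.insert_comm α'' α' {e}] at pac
  rw [Finset.insert_comm α' α, Finset.insert_comm α'' α] at tbc_d tbc_e
  linarith
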